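/- arXiv:1907.04673 — 2 statements merged into one kernel-verified Lean document; each statement's English description precedes it below -/
import Mathlib

section
/- The right counit ε_r of the Connes–Moscovici algebra satisfies the right bialgebroid character property: ε_r(h h') = ε_r(s_r(ε_r(h)) · h') = ε_r(t_r(ε_r(h)) · h') for all h, h' ∈ H. -/
open TensorProduct

noncomputable section

/-- `(id ⊗ Δ) ∘ Δ : Q → Q ⊗ (Q ⊗ Q)`, producing the Sweedler legs
`q₍₁₎ ⊗ q₍₂₎ ⊗ q₍₃₎` of the iterated coproduct. -/
def comul2 (Q : Type*) [Ring Q] [HopfAlgebra ℂ Q] :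
    Q →ₗ[ℂ] Q ⊗[ℂ] (Q ⊗[ℂ] Q) :=
  (LinearMap.lTensor Q (Coalgebra.comul (R := ℂ))).comp (Coalgebra.comul (R := ℂ))

/-- The right-hand side `Σ a (q₍₁₎·a') ⊗ q₍₂₎ q' ⊗ (q₍₃₎·b') b` of the
Connes–Moscovici product formula on `H = A ⊗ Q ⊗ A`. -/
def cmMulRHS {Q A : Type*} [Ring Q] [HopfAlgebra ℂ Q] [Ring A] [Algebra ℂ A]
    (act : Q →ₗ[ℂ] A →ₗ[ℂ] A) (a : A) (q : Q) (b : A) (a' : A) (q' : Q) (b' : A) :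
    A ⊗[ℂ] (Q ⊗[ℂ] A) :=
  TensorProduct.map ((LinearMap.mulLeft ℂ a).comp (act.flip a'))
    (TensorProduct.map (LinearMap.mulRight ℂ q')
      ((LinearMap.mulRight ℂ b).comp (act.flip b')))
    (comul2 Q q)

open Coalgebra WithConv in
/-- The convolution multiple `q ↦ ε(q) • b` of the unit. -/
def convConst (C : Type*) {B : Type*} [AddCommMonoid C] [Module ℂ C] [Coalgebra ℂ C]
    [Semiring B] [Algebra ℂ B] (b : B) : WithConv (C →ₗ[ℂ] B) :=
  toConv (LinearMap.toSpanSingleton ℂ B b ∘ₗ counit)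

theorem mul_eq_mul_of_two_sided_inverse {M : Type*} [Monoid M] {r s f g : M}
    (hsr : s * r = 1) (hrs : r * s = 1) (h : r * g = f * r) : s * f = g * s := by
  rw [← mul_one (s * f), ← hrs, mul_assoc, ← mul_assoc f, ← h, mul_assoc, ← mul_assoc s,
    hsr, one_mul]

section Convolution

open Coalgebra WithConv

variable {C B : Type*} [AddCommMonoid C] [Module ℂ C] [Coalgebra ℂ C] [Semiring B] [Algebra ℂ B]

theorem convMul_convConst_apply (f : WithConv (C →ₗ[ℂ] B)) (b : B) (q : C) :
    (f * convConst C b) q = f q * b := by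
  have h := congrArg (fun t => LinearMap.mul' ℂ B
    (TensorProduct.map f.ofConv (LinearMap.toSpanSingleton ℂ B b) t))
    (lTensor_counit_comul (R := ℂ) q)
  rw [← LinearMap.comp_apply, ← LinearMap.comp_apply, LinearMap.comp_assoc,
    LinearMap.map_comp_lTensor] at h
  simpa using! h

theorem convConst_convMul_apply (f : WithConv (C →ₗ[ℂ] B)) (b : B) (q : C) :
    (convConst C b * f) q = b * f q := by
  have h := congrArg (fun t => LinearMap.mul' ℂ B
    (TensorProduct.map (LinearMap.toSpanSingleton ℂ B b) f.ofConv t))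
    (rTensor_counit_comul (R := ℂ) q)
  rw [← LinearMap.comp_apply, ← LinearMap.comp_apply, LinearMap.comp_assoc,
    LinearMap.map_comp_rTensor] at h
  simpa using! h

end Convolution

section Antipode

open Coalgebra HopfAlgebra

variable {Q : Type*} [Ring Q] [HopfAlgebra ℂ Q] {ι : Type*} {q : Q}

theorem sum_antipode_right_mul_left
    (hT : ∀ q : Q, antipode ℂ (antipode ℂ q) = q) (r : Repr ℂ q ι) :
    ∑ i ∈ r.index, antipode ℂ (r.right i) * r.left i = algebraMap ℂ Q (counit q) := by
  have h := congrArg (antipode ℂ) (sum_antipode_mul_eq_smul r)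
  simpa [antipode_mul_antidistrib, hT, Algebra.algebraMap_eq_smul_one] using h

theorem sum_right_mul_antipode_left
    (hT : ∀ q : Q, antipode ℂ (antipode ℂ q) = q) (r : Repr ℂ q ι) :
    ∑ i ∈ r.index, r.right i * antipode ℂ (r.left i) = algebraMap ℂ Q (counit q) := by
  have h := congrArg (antipode ℂ) (sum_mul_antipode_eq_smul r)
  simpa [antipode_mul_antidistrib, hT, Algebra.algebraMap_eq_smul_one] using h

end Antipode

section ModuleAlgebra

open Coalgebra HopfAlgebra WithConv

variable {Q A : Type*} [Ring Q] [HopfAlgebra ℂ Q] [Ring A] [Algebra ℂ A]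

/-- `Σ T(q₍₁₎)·((q₍₂₎·b) c) = b (T(q)·c)`. -/
theorem sum_antipode_act_act_mul (ρ : Q →ₐ[ℂ] Module.End ℂ A)
    (hρ : ∀ (q : Q) (a a' : A), ρ q (a * a') = LinearMap.mul' ℂ A
      (TensorProduct.map (ρ.toLinearMap.flip a) (ρ.toLinearMap.flip a') (comul (R := ℂ) q)))
    {ι : Type*} {q : Q} (r : Repr ℂ q ι) (b c : A) :
    ∑ i ∈ r.index, ρ (antipode ℂ (r.left i)) (ρ (r.right i) b * c) =
      b * ρ (antipode ℂ q) c := by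
  let R : WithConv (Q →ₗ[ℂ] Module.End ℂ A) := toConv ρ.toLinearMap
  let S : WithConv (Q →ₗ[ℂ] Module.End ℂ A) := toConv (ρ.toLinearMap ∘ₗ antipode ℂ)
  let F : WithConv (Q →ₗ[ℂ] Module.End ℂ A) :=
    toConv (LinearMap.mul ℂ A ∘ₗ ρ.toLinearMap.flip b)
  have hSR : S * R = 1 := by
    ext x : 2
    rw [(ℛ ℂ x).convMul_apply]
    simp [R, S, ← map_mul, ← map_sum, sum_antipode_mul_eq_algebraMap_counit]
  have hRS : R * S = 1 := by
    ext x : 2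
    rw [(ℛ ℂ x).convMul_apply]
    simp [R, S, ← map_mul, ← map_sum, sum_mul_antipode_eq_algebraMap_counit]
  have hFR : R * convConst Q (B := Module.End ℂ A) (LinearMap.mulLeft ℂ b) = F * R := by
    ext x y
    rw [convMul_convConst_apply, (ℛ ℂ x).convMul_apply]
    simp [R, F, hρ, ← (ℛ ℂ x).eq]
  have key : S * F = convConst Q (B := Module.End ℂ A) (LinearMap.mulLeft ℂ b) * S :=
    mul_eq_mul_of_two_sided_inverse (M := WithConv (Q →ₗ[ℂ] Module.End ℂ A)) hSR hRS hFR
  have := congrArg (fun f => f q c) key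
  simp only [convConst_convMul_apply] at this
  simpa [r.convMul_apply, S, F] using! this

/-- `Σ T(q₍₂₎)·(c (q₍₁₎·a)) = (T(q)·c) a`, if `T` is an involution. -/
theorem sum_antipode_act_mul_act (hT : ∀ q : Q, antipode ℂ (antipode ℂ q) = q)
    (ρ : Q →ₐ[ℂ] Module.End ℂ A)
    (hρ : ∀ (q : Q) (a a' : A), ρ q (a * a') = LinearMap.mul' ℂ A
      (TensorProduct.map (ρ.toLinearMap.flip a) (ρ.toLinearMap.flip a') (comul (R := ℂ) q)))
    {ι : Type*} {q : Q} (r : Repr ℂ q ι) (a c : A) :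
    ∑ i ∈ r.index, ρ (antipode ℂ (r.right i)) (c * ρ (r.left i) a) =
      ρ (antipode ℂ q) c * a := by
  let o : Module.End ℂ A →ₗ[ℂ] (Module.End ℂ A)ᵐᵒᵖ := (MulOpposite.opLinearEquiv ℂ).toLinearMap
  let R : WithConv (Q →ₗ[ℂ] (Module.End ℂ A)ᵐᵒᵖ) := toConv (o ∘ₗ ρ.toLinearMap)
  let S : WithConv (Q →ₗ[ℂ] (Module.End ℂ A)ᵐᵒᵖ) := toConv (o ∘ₗ ρ.toLinearMap ∘ₗ antipode ℂ)
  let G : WithConv (Q →ₗ[ℂ] (Module.End ℂ A)ᵐᵒᵖ) :=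
    toConv (o ∘ₗ (LinearMap.mul ℂ A).flip ∘ₗ ρ.toLinearMap.flip a)
  have hSR : S * R = 1 := by
    ext x : 2
    rw [(ℛ ℂ x).convMul_apply]
    simp [R, S, o, ← MulOpposite.op_mul, ← Finset.op_sum, ← map_mul, ← map_sum,
      sum_right_mul_antipode_left hT]
  have hRS : R * S = 1 := by
    ext x : 2
    rw [(ℛ ℂ x).convMul_apply]
    simp [R, S, o, ← MulOpposite.op_mul, ← Finset.op_sum, ← map_mul, ← map_sum,
      sum_antipode_right_mul_left hT]
  have hRG : convConst Q (MulOpposite.op (LinearMap.mulRight ℂ a)) * R = R * G := by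
    ext x : 2
    rw [convConst_convMul_apply, (ℛ ℂ x).convMul_apply]
    apply MulOpposite.unop_injective
    ext y
    simp [R, G, o, hρ, ← (ℛ ℂ x).eq]
  have key : S * convConst Q (MulOpposite.op (LinearMap.mulRight ℂ a)) = G * S :=
    mul_eq_mul_of_two_sided_inverse hSR hRS hRG.symm
  have := congrArg (fun f => (f q).unop c) key.symm
  simp only [convMul_convConst_apply] at this
  simpa [r.convMul_apply, S, G, o] using! this

end ModuleAlgebra

/-- The right counit `ε_r(a ⊗ q ⊗ b) = T(q)·(ba)` of the Connes–Moscovici algebra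
satisfies the right bialgebroid character property
`ε_r(h h') = ε_r(s_r(ε_r h) h') = ε_r(t_r(ε_r h) h')`, where
`s_r(x) = 1 ⊗ 1 ⊗ x` and `t_r(x) = x ⊗ 1 ⊗ 1`. -/
theorem cm_right_counit_character
    {Q A : Type*} [Ring Q] [HopfAlgebra ℂ Q] [Ring A] [Algebra ℂ A]
    (act : Q →ₗ[ℂ] A →ₗ[ℂ] A)
    (hact_one : ∀ a : A, act 1 a = a)
    (hact_mul : ∀ (q q' : Q) (a : A), act (q * q') a = act q (act q' a))
    (hact_alg_mul : ∀ (q : Q) (a a' : A),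
      act q (a * a') =
        LinearMap.mul' ℂ A
          (TensorProduct.map (act.flip a) (act.flip a') (Coalgebra.comul (R := ℂ) q)))
    (hact_alg_one : ∀ q : Q, act q 1 = Coalgebra.counit (R := ℂ) q • (1 : A))
    -- the antipode `T` of `Q` is an involution:
    (hT : ∀ q : Q, HopfAlgebra.antipode (R := ℂ) (HopfAlgebra.antipode (R := ℂ) q) = q)
    -- the Connes–Moscovici multiplication on `H`:
    (m : (A ⊗[ℂ] (Q ⊗[ℂ] A)) →ₗ[ℂ] (A ⊗[ℂ] (Q ⊗[ℂ] A)) →ₗ[ℂ] (A ⊗[ℂ] (Q ⊗[ℂ] A)))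
    (hm : ∀ (a : A) (q : Q) (b a' : A) (q' : Q) (b' : A),
      m (a ⊗ₜ[ℂ] (q ⊗ₜ[ℂ] b)) (a' ⊗ₜ[ℂ] (q' ⊗ₜ[ℂ] b')) = cmMulRHS act a q b a' q' b')
    -- the right counit `ε_r : H → A`, `ε_r(a ⊗ q ⊗ b) = T(q)·(ba)`:
    (εr : (A ⊗[ℂ] (Q ⊗[ℂ] A)) →ₗ[ℂ] A)
    (hεr : ∀ (a : A) (q : Q) (b : A),
      εr (a ⊗ₜ[ℂ] (q ⊗ₜ[ℂ] b)) = act (HopfAlgebra.antipode (R := ℂ) q) (b * a)) :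
    ∀ h h' : A ⊗[ℂ] (Q ⊗[ℂ] A),
      εr (m h h') = εr (m ((1 : A) ⊗ₜ[ℂ] ((1 : Q) ⊗ₜ[ℂ] (εr h))) h') ∧
      εr (m h h') = εr (m ((εr h) ⊗ₜ[ℂ] ((1 : Q) ⊗ₜ[ℂ] (1 : A))) h') := by
  let ρ : Q →ₐ[ℂ] Module.End ℂ A := AlgHom.ofLinearMap act (LinearMap.ext hact_one)
    (fun x y => LinearMap.ext (hact_mul x y))
  have hmul : ∀ (a : A) (q : Q) (b a' : A) (q' : Q) (b' : A),
      εr (m (a ⊗ₜ[ℂ] (q ⊗ₜ[ℂ] b)) (a' ⊗ₜ[ℂ] (q' ⊗ₜ[ℂ] b'))) =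
        act (HopfAlgebra.antipode ℂ q')
          (b' * act (HopfAlgebra.antipode ℂ q) (b * a) * a') := by
    intro a q b a' q' b'
    let r := Coalgebra.Repr.arbitrary ℂ q
    have h₁ : ∀ i, (∑ j ∈ (Coalgebra.Repr.arbitrary ℂ (r.right i)).index, _) = _ := fun i =>
      sum_antipode_act_act_mul ρ hact_alg_mul (Coalgebra.Repr.arbitrary ℂ (r.right i)) b'
        (b * a * act (r.left i) a')
    have h₂ := sum_antipode_act_mul_act hT ρ hact_alg_mul r a' (b * a)
    have hρ : ∀ x, ρ x = act x := fun _ => rfl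
    simp only [hρ] at h₁ h₂
    rw [hm, cmMulRHS, comul2, LinearMap.comp_apply, ← r.eq]
    simp only [map_sum, LinearMap.lTensor_tmul]
    rw [mul_assoc, ← h₂, Finset.mul_sum, map_sum]
    refine Finset.sum_congr rfl fun i _ => ?_
    rw [← h₁ i, ← (Coalgebra.Repr.arbitrary ℂ (r.right i)).eq]
    simp [TensorProduct.tmul_sum, hεr, HopfAlgebra.antipode_mul_antidistrib, hact_mul, mul_assoc]
  intro h h'
  induction h' using TensorProduct.induction_on with
  | zero => simp
  | add x y hx hy => simp only [map_add, ← hx.1, ← hy.1, ← hx.2, ← hy.2, and_self]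
  | tmul a' t =>
  induction t using TensorProduct.induction_on with
  | zero => simp
  | add x y hx hy =>
    simp only [TensorProduct.tmul_add, map_add, ← hx.1, ← hy.1, ← hx.2, ← hy.2, and_self]
  | tmul q' b' =>
  have hmul' : εr (m h (a' ⊗ₜ[ℂ] (q' ⊗ₜ[ℂ] b'))) =
      act (HopfAlgebra.antipode ℂ q') (b' * εr h * a') := by
    induction h using TensorProduct.induction_on with
    | zero => simp
    | add x y hx hy => simp [hx, hy, mul_add, add_mul]
    | tmul a t =>
    induction t using TensorProduct.induction_on with
    | zero => simp
    | add x y hx hy => simp [TensorProduct.tmul_add, hx, hy, mul_add, add_mul]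
    | tmul q b => rw [hmul, hεr]
  simp [hmul', hmul, hact_one]
end
end

section
/- The antipode S of the Connes–Moscovici algebra satisfies the twisted linearity axiom S(t_l(a₁) h t_r(a₂)) = s_r(a₂) S(h) s_l(a₁); explicitly, for all c, c' ∈ A and h ∈ H: S((1 ⊗ 1 ⊗ c)·h·(c' ⊗ 1 ⊗ 1)) = (1 ⊗ 1 ⊗ c')·S(h)·(c ⊗ 1 ⊗ 1), where all products are taken in H. -/
open TensorProduct

noncomputable section

/-- The order-reversing map `A ⊗ (Q ⊗ A) → A ⊗ (Q ⊗ A)`, `x ⊗ y ⊗ z ↦ z ⊗ y ⊗ x`. -/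
def cmRev {Q A : Type*} [Ring Q] [HopfAlgebra ℂ Q] [Ring A] [Algebra ℂ A] :
    (A ⊗[ℂ] (Q ⊗[ℂ] A)) →ₗ[ℂ] (A ⊗[ℂ] (Q ⊗[ℂ] A)) :=
  (TensorProduct.congr (LinearEquiv.refl ℂ A) (TensorProduct.comm ℂ Q A) ≪≫ₗ
    (TensorProduct.assoc ℂ A A Q).symm ≪≫ₗ
    TensorProduct.congr (TensorProduct.comm ℂ A A) (LinearEquiv.refl ℂ Q) ≪≫ₗ
    TensorProduct.assoc ℂ A A Q ≪≫ₗ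
    TensorProduct.congr (LinearEquiv.refl ℂ A) (TensorProduct.comm ℂ A Q)).toLinearMap

/-- The value `Σ T(q₍₃₎)·b ⊗ T(q₍₂₎) ⊗ T(q₍₁₎)·a` of the antipode of the
Connes–Moscovici algebra on an elementary tensor `a ⊗ q ⊗ b`. -/
def cmAntipodeRHS {Q A : Type*} [Ring Q] [HopfAlgebra ℂ Q] [Ring A] [Algebra ℂ A]
    (act : Q →ₗ[ℂ] A →ₗ[ℂ] A) (a : A) (q : Q) (b : A) :
    A ⊗[ℂ] (Q ⊗[ℂ] A) :=
  cmRev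
    (TensorProduct.map ((act.flip a).comp (HopfAlgebra.antipode (R := ℂ)))
      (TensorProduct.map (HopfAlgebra.antipode (R := ℂ))
        ((act.flip b).comp (HopfAlgebra.antipode (R := ℂ))))
      (comul2 Q q))

namespace HopfAlgebra

open Coalgebra LinearMap WithConv

variable {R Q : Type*} [CommSemiring R] [Semiring Q] [HopfAlgebra R Q]

/-- `Σ S(p₍₁₎) p₍₂₎ ⊗ S(x) p₍₃₎ = 1 ⊗ S(x) p`. -/
lemma antipode_tmul_mul_comul (x p : Q) :
    mul' R (Q ⊗[R] Q)
      (map (map (antipode R) (antipode R) ∘ₗ (TensorProduct.comm R Q Q).toLinearMap) comul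
        ((TensorProduct.assoc R Q Q Q).symm (x ⊗ₜ[R] comul p))) =
      (1 : Q) ⊗ₜ[R] (antipode R x * p) := by
  have key : ∀ s : Q ⊗[R] Q,
      mul' R (Q ⊗[R] Q)
        (map (map (antipode R) (antipode R) ∘ₗ (TensorProduct.comm R Q Q).toLinearMap) comul
          ((TensorProduct.assoc R Q Q Q).symm (x ⊗ₜ[R] s))) =
      map (mul' R Q ∘ₗ (antipode R).rTensor Q) (mulLeft R (antipode R x))
        ((TensorProduct.assoc R Q Q Q).symm (comul.lTensor Q s)) := by
    intro s
    induction s with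
    | zero => simp
    | add s t hs ht => simp only [tmul_add, map_add, hs, ht]
    | tmul y v =>
      simp only [assoc_symm_tmul, map_tmul, LinearMap.comp_apply, LinearEquiv.coe_coe, comm_tmul,
        mul'_apply, lTensor_tmul]
      induction (comul v : Q ⊗[R] Q) with
      | zero => simp
      | add s t hs ht => simp only [tmul_add, map_add, mul_add, hs, ht]
      | tmul z w => simp
  rw [key, coassoc_symm_apply, map_rTensor, LinearMap.comp_assoc, mul_antipode_rTensor_comul]
  have := congr(map (Algebra.linearMap R Q) (mulLeft R (antipode R x))
    $(rTensor_counit_comul (R := R) p))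
  rw [map_rTensor] at this
  simpa using this

/-- The antipode reverses the comultiplication. -/
lemma comul_antipode (q : Q) :
    comul (antipode R q) =
      map (antipode R) (antipode R) (TensorProduct.comm R Q Q (comul q)) := by
  have left_inv : toConv (map (antipode R) (antipode R) ∘ₗ
      (TensorProduct.comm R Q Q).toLinearMap ∘ₗ comul) * toConv (comul (R := R) (A := Q)) = 1 := by
    ext c
    have key : ∀ t : Q ⊗[R] Q,
        mul' R (Q ⊗[R] Q)
          (map (map (antipode R) (antipode R) ∘ₗ (TensorProduct.comm R Q Q).toLinearMap) comul
            ((TensorProduct.assoc R Q Q Q).symm (comul.lTensor Q t))) =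
          (1 : Q) ⊗ₜ[R] mul' R Q ((antipode R).rTensor Q t) := by
      intro t
      induction t with
      | zero => simp
      | add s t hs ht => simp only [map_add, tmul_add, hs, ht]
      | tmul x p => simpa using antipode_tmul_mul_comul x p
    have := key (comul c)
    rw [coassoc_symm_apply, map_rTensor, mul_antipode_rTensor_comul_apply] at this
    rw [convMul_apply, convOne_apply]
    refine this.trans ?_
    rw [Algebra.algebraMap_eq_smul_one, tmul_smul, Algebra.algebraMap_eq_smul_one]
    rfl
  exact (LinearMap.congr_fun (congr_arg WithConv.ofConv
    (left_inv_eq_right_inv left_inv comul_right_inv)) q).symm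

/-- If the antipode is involutive, then `Σ S(q₍₂₎) q₍₁₎ = ε(q) 1`. -/
lemma mul_antipode_rTensor_comm_comul (hS : Function.Involutive (antipode R (A := Q))) (q : Q) :
    mul' R Q ((antipode R).rTensor Q (TensorProduct.comm R Q Q (comul q))) =
      algebraMap R Q (counit q) := by
  have key : ∀ t : Q ⊗[R] Q,
      antipode R (mul' R Q ((antipode R).rTensor Q (TensorProduct.comm R Q Q t))) =
        mul' R Q ((antipode R).rTensor Q t) := by
    intro t
    induction t with
    | zero => simp
    | add s t hs ht => simp only [map_add, hs, ht]
    | tmul x y => simp [antipode_mul_antidistrib, hS y]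
  apply hS.injective
  rw [key, mul_antipode_rTensor_comul_apply, Algebra.algebraMap_eq_smul_one, map_smul,
    antipode_one]

end HopfAlgebra

section ModuleAlgebra

open Coalgebra HopfAlgebra LinearMap

variable {Q A : Type*} [Ring Q] [HopfAlgebra ℂ Q] [Ring A] [Algebra ℂ A]

/-- `Σ T(q₍₂₎)·(a (q₍₁₎·c)) = (T(q)·a) c` in a module algebra over a Hopf algebra with involutive
antipode `T`. -/
lemma lift_act_antipode_mul_act (act : Q →ₗ[ℂ] A →ₗ[ℂ] A)
    (hact_one : ∀ a : A, act 1 a = a)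
    (hact_mul : ∀ (q q' : Q) (a : A), act (q * q') a = act q (act q' a))
    (hact_alg_mul : ∀ (q : Q) (a a' : A),
      act q (a * a') = mul' ℂ A (map (act.flip a) (act.flip a') (comul (R := ℂ) q)))
    (hT : Function.Involutive (antipode ℂ (A := Q))) (a c : A) (q : Q) :
    lift act (map (antipode ℂ) (mulLeft ℂ a ∘ₗ act.flip c)
      (TensorProduct.comm ℂ Q Q (comul q))) = act (antipode ℂ q) a * c := by
  have key : ∀ t : Q ⊗[ℂ] Q,
      lift act (map (antipode ℂ) (mulLeft ℂ a ∘ₗ act.flip c) (TensorProduct.comm ℂ Q Q t)) =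
        mul' ℂ A (TensorProduct.comm ℂ A A
          (map (act.flip c ∘ₗ mul' ℂ Q ∘ₗ (antipode ℂ).rTensor Q ∘ₗ
              (TensorProduct.comm ℂ Q Q).toLinearMap) (act.flip a ∘ₗ antipode ℂ)
            ((TensorProduct.assoc ℂ Q Q Q).symm (comul.lTensor Q t)))) := by
    intro t
    induction t with
    | zero => simp
    | add s t hs ht => simp only [map_add, hs, ht]
    | tmul x y =>
      simp only [comm_tmul, map_tmul, lift.tmul, LinearMap.comp_apply, mulLeft_apply, flip_apply,
        hact_alg_mul, comul_antipode, lTensor_tmul]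
      induction (comul y : Q ⊗[ℂ] Q) with
      | zero => simp
      | add s t hs ht => simp only [tmul_add, map_add, hs, ht]
      | tmul z w => simp [hact_mul]
  have counit_act : (act.flip c ∘ₗ mul' ℂ Q ∘ₗ (antipode ℂ).rTensor Q ∘ₗ
      (TensorProduct.comm ℂ Q Q).toLinearMap) ∘ₗ comul = toSpanSingleton ℂ A c ∘ₗ counit := by
    ext y
    simp [mul_antipode_rTensor_comm_comul hT, Algebra.algebraMap_eq_smul_one, hact_one]
  rw [key, coassoc_symm_apply, map_rTensor, counit_act, ← map_rTensor, rTensor_counit_comul]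
  simp

/-- Right multiplication by `c ⊗ 1 ⊗ 1` in the Connes–Moscovici algebra, restricted to the first
two legs: `a ⊗ q ↦ Σ a (q₍₁₎·c) ⊗ q₍₂₎`. -/
def cmMulRightLegs (act : Q →ₗ[ℂ] A →ₗ[ℂ] A) (c : A) : A ⊗[ℂ] Q →ₗ[ℂ] A ⊗[ℂ] Q :=
  (mul' ℂ A ∘ₗ (act.flip c).lTensor A).rTensor Q ∘ₗ
    (TensorProduct.assoc ℂ A Q Q).symm.toLinearMap ∘ₗ comul.lTensor A

lemma cmMulRightLegs_tmul (act : Q →ₗ[ℂ] A →ₗ[ℂ] A) (c a : A) (q : Q) :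
    cmMulRightLegs act c (a ⊗ₜ[ℂ] q) = (mulLeft ℂ a ∘ₗ act.flip c).rTensor Q (comul q) := by
  simp only [cmMulRightLegs, LinearMap.comp_apply, LinearEquiv.coe_coe, lTensor_tmul]
  induction (comul q : Q ⊗[ℂ] Q) with
  | zero => simp
  | add s t hs ht => simp only [tmul_add, map_add, hs, ht]
  | tmul z w => simp

/-- `Σ (T(p₍₃₎)·b) (T(p₍₂₎)·c) ⊗ T(p₍₁₎) = Σ T(p₍₂₎)·(b c) ⊗ T(p₍₁₎)`. -/
lemma cmMulRightLegs_antipode (act : Q →ₗ[ℂ] A →ₗ[ℂ] A)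
    (hact_alg_mul : ∀ (q : Q) (a a' : A),
      act q (a * a') = mul' ℂ A (map (act.flip a) (act.flip a') (comul (R := ℂ) q)))
    (b c : A) (p : Q) :
    cmMulRightLegs act c
        (TensorProduct.comm ℂ Q A (map (antipode ℂ) (act.flip b ∘ₗ antipode ℂ) (comul p))) =
      TensorProduct.comm ℂ Q A
        (map (antipode ℂ) (act.flip (b * c) ∘ₗ antipode ℂ) (comul p)) := by
  have key : ∀ t : Q ⊗[ℂ] Q,
      cmMulRightLegs act c
          (TensorProduct.comm ℂ Q A (map (antipode ℂ) (act.flip b ∘ₗ antipode ℂ) t)) =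
        TensorProduct.comm ℂ Q A
          (map (antipode ℂ) (mul' ℂ A ∘ₗ map (act.flip b) (act.flip c) ∘ₗ
              map (antipode ℂ) (antipode ℂ) ∘ₗ (TensorProduct.comm ℂ Q Q).toLinearMap)
            (TensorProduct.assoc ℂ Q Q Q (comul.rTensor Q t))) := by
    intro t
    induction t with
    | zero => simp
    | add s t hs ht => simp only [map_add, hs, ht]
    | tmul x y =>
      simp only [comm_tmul, map_tmul, LinearMap.comp_apply, flip_apply, cmMulRightLegs_tmul,
        comul_antipode, rTensor_tmul]
      induction (comul x : Q ⊗[ℂ] Q) with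
      | zero => simp
      | add s t hs ht => simp only [add_tmul, map_add, hs, ht]
      | tmul z w => simp
  have act_mul : (mul' ℂ A ∘ₗ map (act.flip b) (act.flip c) ∘ₗ map (antipode ℂ) (antipode ℂ) ∘ₗ
      (TensorProduct.comm ℂ Q Q).toLinearMap) ∘ₗ comul = act.flip (b * c) ∘ₗ antipode ℂ := by
    ext y
    simp only [LinearMap.comp_apply, LinearEquiv.coe_coe, flip_apply, hact_alg_mul, comul_antipode]
  rw [key, coassoc_apply, map_lTensor, act_mul]

lemma cmRev_tmul (x : A) (s : Q ⊗[ℂ] A) :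
    cmRev (x ⊗ₜ[ℂ] s) = TensorProduct.assoc ℂ A Q A (TensorProduct.comm ℂ Q A s ⊗ₜ[ℂ] x) := by
  induction s with
  | zero => simp
  | add s t hs ht => simp only [tmul_add, add_tmul, map_add, hs, ht]
  | tmul y z => simp [cmRev]

lemma cmAntipodeRHS_eq (act : Q →ₗ[ℂ] A →ₗ[ℂ] A) (a : A) (q : Q) (b : A) :
    cmAntipodeRHS act a q b =
      cmRev (map (act.flip a ∘ₗ antipode ℂ)
        (map (antipode ℂ) (act.flip b ∘ₗ antipode ℂ) ∘ₗ comul) (comul q)) := by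
  rw [cmAntipodeRHS, comul2, LinearMap.comp_apply, map_lTensor]

lemma cmMulRHS_one_one_left (act : Q →ₗ[ℂ] A →ₗ[ℂ] A) (hact_one : ∀ a : A, act 1 a = a)
    (c a : A) (q : Q) (b : A) :
    cmMulRHS act 1 1 c a q b = a ⊗ₜ[ℂ] (q ⊗ₜ[ℂ] (b * c)) := by
  simp [cmMulRHS, comul2, Algebra.TensorProduct.one_def, hact_one]

lemma cmMulRHS_one_one_right (act : Q →ₗ[ℂ] A →ₗ[ℂ] A)
    (hact_alg_one : ∀ q : Q, act q 1 = counit (R := ℂ) q • (1 : A)) (a : A) (q : Q) (b c : A) :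
    cmMulRHS act a q b c 1 1 =
      map (mulLeft ℂ a ∘ₗ act.flip c) ((TensorProduct.mk ℂ Q A).flip b) (comul q) := by
  have counit_leg : map (mulRight ℂ 1) (mulRight ℂ b ∘ₗ act.flip 1) ∘ₗ comul =
      (TensorProduct.mk ℂ Q A).flip b := by
    have act_one : mulRight ℂ b ∘ₗ act.flip 1 = toSpanSingleton ℂ A b ∘ₗ counit := by
      ext y
      simp [hact_alg_one]
    ext y
    rw [LinearMap.comp_apply, act_one, ← map_lTensor, lTensor_counit_comul]
    simp
  rw [cmMulRHS, comul2, LinearMap.comp_apply, map_lTensor, counit_leg]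

end ModuleAlgebra

/-- Twisted linearity of the antipode of the Connes–Moscovici Hopf algebroid:
`S(t_l(c) h t_r(c')) = s_r(c') S(h) s_l(c)`, i.e.
`S((1 ⊗ 1 ⊗ c)·h·(c' ⊗ 1 ⊗ 1)) = (1 ⊗ 1 ⊗ c')·S(h)·(c ⊗ 1 ⊗ 1)`. -/
theorem cm_antipode_twisted_linearity
    {Q A : Type*} [Ring Q] [HopfAlgebra ℂ Q] [Ring A] [Algebra ℂ A]
    (act : Q →ₗ[ℂ] A →ₗ[ℂ] A)
    (hact_one : ∀ a : A, act 1 a = a)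
    (hact_mul : ∀ (q q' : Q) (a : A), act (q * q') a = act q (act q' a))
    (hact_alg_mul : ∀ (q : Q) (a a' : A),
      act q (a * a') =
        LinearMap.mul' ℂ A
          (TensorProduct.map (act.flip a) (act.flip a') (Coalgebra.comul (R := ℂ) q)))
    (hact_alg_one : ∀ q : Q, act q 1 = Coalgebra.counit (R := ℂ) q • (1 : A))
    (hT : ∀ q : Q, HopfAlgebra.antipode (R := ℂ) (HopfAlgebra.antipode (R := ℂ) q) = q)
    -- the Connes–Moscovici multiplication on `H`:
    (m : (A ⊗[ℂ] (Q ⊗[ℂ] A)) →ₗ[ℂ] (A ⊗[ℂ] (Q ⊗[ℂ] A)) →ₗ[ℂ] (A ⊗[ℂ] (Q ⊗[ℂ] A)))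
    (hm : ∀ (a : A) (q : Q) (b a' : A) (q' : Q) (b' : A),
      m (a ⊗ₜ[ℂ] (q ⊗ₜ[ℂ] b)) (a' ⊗ₜ[ℂ] (q' ⊗ₜ[ℂ] b')) = cmMulRHS act a q b a' q' b')
    -- the antipode of `H`:
    (S : (A ⊗[ℂ] (Q ⊗[ℂ] A)) →ₗ[ℂ] (A ⊗[ℂ] (Q ⊗[ℂ] A)))
    (hS : ∀ (a : A) (q : Q) (b : A),
      S (a ⊗ₜ[ℂ] (q ⊗ₜ[ℂ] b)) = cmAntipodeRHS act a q b) :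
    ∀ (c c' : A) (h : A ⊗[ℂ] (Q ⊗[ℂ] A)),
      S (m (m ((1 : A) ⊗ₜ[ℂ] ((1 : Q) ⊗ₜ[ℂ] c)) h) (c' ⊗ₜ[ℂ] ((1 : Q) ⊗ₜ[ℂ] (1 : A)))) =
        m (m ((1 : A) ⊗ₜ[ℂ] ((1 : Q) ⊗ₜ[ℂ] c')) (S h)) (c ⊗ₜ[ℂ] ((1 : Q) ⊗ₜ[ℂ] (1 : A))) := by
  intro c c' h
  have hT' : Function.Involutive (HopfAlgebra.antipode ℂ (A := Q)) := hT
  have hmul_left : ∀ (d : A) (h : A ⊗[ℂ] (Q ⊗[ℂ] A)),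
      m ((1 : A) ⊗ₜ[ℂ] ((1 : Q) ⊗ₜ[ℂ] d)) h =
        ((LinearMap.mulRight ℂ d).lTensor Q).lTensor A h := by
    intro d h
    refine LinearMap.congr_fun (TensorProduct.ext_threefold' fun a q b => ?_) h
    simp [hm, cmMulRHS_one_one_left act hact_one]
  have hmul_right : ∀ (a : A) (q : Q) (b d : A),
      m (a ⊗ₜ[ℂ] (q ⊗ₜ[ℂ] b)) (d ⊗ₜ[ℂ] ((1 : Q) ⊗ₜ[ℂ] (1 : A))) =
        TensorProduct.map (LinearMap.mulLeft ℂ a ∘ₗ act.flip d)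
          ((TensorProduct.mk ℂ Q A).flip b) (Coalgebra.comul q) := by
    intro a q b d
    rw [hm, cmMulRHS_one_one_right act hact_alg_one]
  have hmul_right_assoc : ∀ (u : A ⊗[ℂ] Q) (b d : A),
      m (TensorProduct.assoc ℂ A Q A (u ⊗ₜ[ℂ] b)) (d ⊗ₜ[ℂ] ((1 : Q) ⊗ₜ[ℂ] (1 : A))) =
        TensorProduct.assoc ℂ A Q A (cmMulRightLegs act d u ⊗ₜ[ℂ] b) := by
    intro u b d
    induction u with
    | zero => simp
    | add u v hu hv => simp only [TensorProduct.add_tmul, map_add, LinearMap.add_apply, hu, hv]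
    | tmul a q =>
      rw [TensorProduct.assoc_tmul, hmul_right, cmMulRightLegs_tmul]
      induction (Coalgebra.comul q : Q ⊗[ℂ] Q) with
      | zero => simp
      | add s t hs ht => simp only [TensorProduct.add_tmul, map_add, hs, ht]
      | tmul y z => simp
  induction h with
  | zero => simp
  | add g h hg hh => simp only [map_add, LinearMap.add_apply, hg, hh]
  | tmul a s =>
  induction s with
  | zero => simp
  | add s t hs ht => simp only [TensorProduct.tmul_add, map_add, LinearMap.add_apply, hs, ht]
  | tmul q b =>
  have lhs_eq : ∀ t : Q ⊗[ℂ] Q,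
      S (TensorProduct.map (LinearMap.mulLeft ℂ a ∘ₗ act.flip c')
        ((TensorProduct.mk ℂ Q A).flip (b * c)) t) =
      cmRev (TensorProduct.map
        (TensorProduct.lift act ∘ₗ TensorProduct.map (HopfAlgebra.antipode ℂ)
          (LinearMap.mulLeft ℂ a ∘ₗ act.flip c') ∘ₗ (TensorProduct.comm ℂ Q Q).toLinearMap)
        (TensorProduct.map (HopfAlgebra.antipode ℂ)
          (act.flip (b * c) ∘ₗ HopfAlgebra.antipode ℂ) ∘ₗ Coalgebra.comul)
        ((TensorProduct.assoc ℂ Q Q Q).symm ((Coalgebra.comul).lTensor Q t))) := by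
    intro t
    induction t with
    | zero => simp
    | add s t hs ht => simp only [map_add, hs, ht]
    | tmul x y =>
      rw [TensorProduct.map_tmul, LinearMap.flip_apply, TensorProduct.mk_apply, hS,
        cmAntipodeRHS_eq, LinearMap.lTensor_tmul]
      induction (Coalgebra.comul y : Q ⊗[ℂ] Q) with
      | zero => simp
      | add s t hs ht => simp only [TensorProduct.tmul_add, map_add, hs, ht]
      | tmul z w => simp
  have act_eq : (TensorProduct.lift act ∘ₗ TensorProduct.map (HopfAlgebra.antipode ℂ)
      (LinearMap.mulLeft ℂ a ∘ₗ act.flip c') ∘ₗ (TensorProduct.comm ℂ Q Q).toLinearMap) ∘ₗ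
        Coalgebra.comul =
      LinearMap.mulRight ℂ c' ∘ₗ act.flip a ∘ₗ HopfAlgebra.antipode ℂ := by
    ext y
    simpa using lift_act_antipode_mul_act act hact_one hact_mul hact_alg_mul hT' a c' y
  rw [hmul_left, LinearMap.lTensor_tmul, LinearMap.lTensor_tmul, LinearMap.mulRight_apply,
    hmul_right, lhs_eq, Coalgebra.coassoc_symm_apply, LinearMap.map_rTensor, act_eq,
    hmul_left, hS, cmAntipodeRHS_eq]
  induction (Coalgebra.comul q : Q ⊗[ℂ] Q) with
  | zero => simp
  | add s t hs ht => simp only [map_add, LinearMap.add_apply, hs, ht]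
  | tmul x p =>
    have lTensor_assoc : ∀ (u : A ⊗[ℂ] Q) (d : A),
        ((LinearMap.mulRight ℂ c').lTensor Q).lTensor A
            (TensorProduct.assoc ℂ A Q A (u ⊗ₜ[ℂ] d)) =
          TensorProduct.assoc ℂ A Q A (u ⊗ₜ[ℂ] (d * c')) := by
      intro u d
      induction u with
      | zero => simp
      | add u v hu hv => simp only [TensorProduct.add_tmul, map_add, hu, hv]
      | tmul y z => simp
    rw [TensorProduct.map_tmul, TensorProduct.map_tmul, cmRev_tmul, cmRev_tmul, lTensor_assoc,
      hmul_right_assoc]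
    simp only [LinearMap.comp_apply, LinearMap.mulRight_apply]
    rw [cmMulRightLegs_antipode act hact_alg_mul]
end
end
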